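/- Let μ be a probability distribution on the k-element subsets of [n] (k ≥ 1) whose generating polynomial g_μ is log-concave, and let p be a probability distribution on [n] with p(i) > 0 for all i. Let c > 1 and let t be an integer with t ≥ c·k². If k·p(i) ≥ (1 + 1/(ck))^{−1} · P_{S∼μ}[i ∈ S] for all i ∈ [n], then the transition kernel P of M_{μ,p}^t satisfies, for every starting state S₀ ∈ supp μ, (1/2) · ∑_{S₁ ∈ binom([n],k)} |P(S₀, S₁) − μ(S₁)| ≤ 5/c. -/

import Mathlib

open Finset

/-- A probability distribution on the `k`-element subsets of `[n]`:
nonnegative, supported on `k`-element sets, summing to `1`. -/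
def IsProbDistOn (n k : ℕ) (μ : Finset (Fin n) → ℝ) : Prop :=
  (∀ S, 0 ≤ μ S) ∧ (∀ S, S.card ≠ k → μ S = 0) ∧ (∑ S : Finset (Fin n), μ S = 1)

/-- The generating polynomial `g_μ(z) = ∑_{|S|=k} μ(S) ∏_{i∈S} z_i`. -/
noncomputable def genPoly (n k : ℕ) (μ : Finset (Fin n) → ℝ) (z : Fin n → ℝ) : ℝ :=
  ∑ S ∈ Finset.univ.filter (fun S : Finset (Fin n) => S.card = k), μ S * ∏ i ∈ S, z i

/-- `g` is log-concave as a function on `ℝ_{≥0}^n`. -/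
def IsLogConcaveOn (n : ℕ) (g : (Fin n → ℝ) → ℝ) : Prop :=
  ∀ x y : Fin n → ℝ, (∀ i, 0 ≤ x i) → (∀ i, 0 ≤ y i) →
    ∀ lam : ℝ, 0 < lam → lam < 1 →
      g x ^ lam * g y ^ (1 - lam) ≤ g (fun i => lam * x i + (1 - lam) * y i)

/-- The marginal `P_{S∼μ}[i ∈ S]`. -/
noncomputable def marginal (n : ℕ) (μ : Finset (Fin n) → ℝ) (i : Fin n) : ℝ :=
  ∑ S ∈ Finset.univ.filter (fun S : Finset (Fin n) => i ∈ S), μ S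

open scoped Classical

/-- The weight `w(τ,S) = μ(τ_S) · ∏_{i∈S} p(τ_i)⁻¹` for a sequence `τ ∈ [n]^r`
and an index set `S ⊆ [r]`. -/
noncomputable def wSeq (n r : ℕ) (μ : Finset (Fin n) → ℝ) (p : Fin n → ℝ)
    (τ : Fin r → Fin n) (S : Finset (Fin r)) : ℝ :=
  μ (S.image τ) * ∏ i ∈ S, (p (τ i))⁻¹

/-- The normalization constant `Z_{μ,p}(τ) = ∑_{S ∈ binom([r],k)} w(τ,S)`. -/
noncomputable def Zconst (n k r : ℕ) (μ : Finset (Fin n) → ℝ) (p : Fin n → ℝ)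
    (τ : Fin r → Fin n) : ℝ :=
  ∑ S ∈ Finset.univ.filter (fun S : Finset (Fin r) => S.card = k), wSeq n r μ p τ S

/-- The distribution `μ_{τ,p}(S) = w(τ,S)/Z_{μ,p}(τ)`, with value `0` when `Z = 0`. -/
noncomputable def muTau (n k r : ℕ) (μ : Finset (Fin n) → ℝ) (p : Fin n → ℝ)
    (τ : Fin r → Fin n) (S : Finset (Fin r)) : ℝ :=
  if Zconst n k r μ p τ = 0 then 0 else wSeq n r μ p τ S / Zconst n k r μ p τ

/-- The interleaving distribution `q_{S₀}` on `[n]^r`: draw `t = r - k` i.i.d. samples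
from `p` and permute the elements of `S₀` into the sequence uniformly at random. -/
noncomputable def interDist (n k r : ℕ) (p : Fin n → ℝ) (S₀ : Finset (Fin n))
    (τ : Fin r → Fin n) : ℝ :=
  (1 / ((Nat.factorial k : ℝ) * (r.choose k : ℝ))) *
    ∑ A ∈ Finset.univ.filter (fun A : Finset (Fin r) => A.card = k),
      ∑ b : {x // x ∈ A} → {y // y ∈ S₀},
        if Function.Bijective b ∧ ∀ i : {x // x ∈ A}, τ i.1 = (b i).1 then
          ∏ i ∈ Finset.univ \ A, p (τ i)
        else 0

/-- The transition kernel `P(S₀, S₁)` of the Markov chain `M_{μ,p}^t`, with `r = t + k`. -/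
noncomputable def kernel (n k t : ℕ) (μ : Finset (Fin n) → ℝ) (p : Fin n → ℝ)
    (S₀ S₁ : Finset (Fin n)) : ℝ :=
  ∑ τ : Fin (t + k) → Fin n,
    interDist n k (t + k) p S₀ τ *
      ∑ S ∈ Finset.univ.filter
          (fun S : Finset (Fin (t + k)) => S.card = k ∧ S.image τ = S₁),
        muTau n k (t + k) μ p τ S

theorem sum_prod_apply_eq_one {ι α : Type*} [Fintype ι] [DecidableEq ι] [Fintype α]
    (ρ : ι → α → ℝ) (hρ : ∀ i, ∑ j, ρ i j = 1) :
    ∑ τ : ι → α, ∏ i, ρ i (τ i) = 1 := by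
  rw [← Fintype.prod_sum]
  simp [hρ]

theorem sum_mul_prod_indicator_le {α : Type*} [Fintype α] [DecidableEq α]
    (f : α → ℝ) (hf : ∀ x, 0 ≤ f x) (hf1 : ∑ x, f x = 1)
    {J : Type*} (v : J → α) (hv : Function.Injective v) (T : Finset J) :
    ∑ x, f x * ∏ j ∈ T, (if x = v j then (1 : ℝ) else 0) ≤ ∏ j ∈ T, f (v j) := by
  classical
  rcases T.eq_empty_or_nonempty with rfl | ⟨j, hj⟩
  · simp [hf1]
  by_cases hT : T = {j}
  · subst hT
    simp
  · obtain ⟨l, hl, hlj⟩ : ∃ l ∈ T, l ≠ j := by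
      by_contra! h
      exact hT (Finset.eq_singleton_iff_unique_mem.2 ⟨hj, h⟩)
    refine le_trans (le_of_eq (Finset.sum_eq_zero fun x _ => ?_))
      (Finset.prod_nonneg fun _ _ => hf _)
    by_cases hx : x = v j
    · rw [Finset.prod_eq_zero hl, mul_zero]
      rw [if_neg]
      rw [hx]
      exact fun h => hlj (hv h).symm
    · rw [Finset.prod_eq_zero hj (if_neg hx), mul_zero]

theorem sum_prod_mul_prod_count_le {ι α J : Type*} [Fintype ι] [DecidableEq ι] [Fintype α]
    [DecidableEq α] [Fintype J] [DecidableEq J]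
    (ρ : ι → α → ℝ) (hρ : ∀ i j, 0 ≤ ρ i j) (hρ1 : ∀ i, ∑ j, ρ i j = 1)
    (v : J → α) (hv : Function.Injective v) :
    ∑ τ : ι → α, (∏ i, ρ i (τ i)) * ∏ j, ∑ i, (if τ i = v j then (1 : ℝ) else 0)
      ≤ ∏ j, ∑ i, ρ i (v j) := by
  simp_rw [Fintype.prod_sum, Finset.mul_sum]
  rw [Finset.sum_comm]
  refine Finset.sum_le_sum fun f _ => ?_
  calc ∑ τ : ι → α, (∏ i, ρ i (τ i)) * ∏ j, (if τ (f j) = v j then (1 : ℝ) else 0)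
      = ∑ τ : ι → α, ∏ i, (ρ i (τ i) *
          ∏ j ∈ Finset.univ.filter (fun j => f j = i), (if τ i = v j then (1 : ℝ) else 0)) := by
        refine Finset.sum_congr rfl fun τ _ => ?_
        rw [Finset.prod_mul_distrib]
        congr 1
        rw [← Finset.prod_fiberwise Finset.univ f]
        refine Finset.prod_congr rfl fun i _ => Finset.prod_congr rfl fun j hj => ?_
        rw [(Finset.mem_filter.1 hj).2]
    _ = ∏ i, ∑ x, (ρ i x *
          ∏ j ∈ Finset.univ.filter (fun j => f j = i), (if x = v j then (1 : ℝ) else 0)) := by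
        rw [Fintype.prod_sum]
    _ ≤ ∏ i, ∏ j ∈ Finset.univ.filter (fun j => f j = i), ρ i (v j) := by
        refine Finset.prod_le_prod (fun i _ => Finset.sum_nonneg fun x _ =>
          mul_nonneg (hρ i x) (Finset.prod_nonneg fun j _ => by split_ifs <;> norm_num)) ?_
        exact fun i _ => sum_mul_prod_indicator_le (ρ i) (hρ i) (hρ1 i) v hv _
    _ = ∏ j, ρ (f j) (v j) := by
        rw [← Finset.prod_fiberwise Finset.univ f (fun j => ρ (f j) (v j))]
        refine Finset.prod_congr rfl fun i _ => Finset.prod_congr rfl fun j hj => ?_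
        rw [(Finset.mem_filter.1 hj).2]

theorem card_transversals_le {ι α : Type*} [Fintype ι] [DecidableEq ι] [DecidableEq α]
    (τ : ι → α) (S : Finset α) :
    (Finset.univ.filter (fun C : Finset ι => C.card = S.card ∧ C.image τ = S)).card
      ≤ ∏ j ∈ S, (Finset.univ.filter (fun i => τ i = j)).card := by
  rw [← Finset.card_pi]
  refine (Finset.card_le_card ?_).trans
    (Finset.card_image_le (f := fun f => S.attach.image fun j => f j.1 j.2))
  intro C hC
  obtain ⟨hc, hC⟩ := (Finset.mem_filter.1 hC).2
  have h : ∀ j ∈ S, ∃ i ∈ C, τ i = j := fun j hj => by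
    rw [← hC] at hj
    exact Finset.mem_image.1 hj
  choose f hfC hf using h
  refine Finset.mem_image.2 ⟨f, by simp [hf], ?_⟩
  refine Finset.eq_of_subset_of_card_le (Finset.image_subset_iff.2 fun j _ => hfC _ _) ?_
  rw [Finset.card_image_of_injective, Finset.card_attach, hc]
  intro j l hjl
  have := congrArg τ hjl
  simp only [hf] at this
  exact Subtype.ext this

theorem wSeq_eq_of_image_eq {n r : ℕ} (μ : Finset (Fin n) → ℝ) (p : Fin n → ℝ)
    {τ : Fin r → Fin n} {C : Finset (Fin r)} {S : Finset (Fin n)}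
    (hcard : C.card = S.card) (hS : C.image τ = S) :
    wSeq n r μ p τ C = μ S * ∏ j ∈ S, (p j)⁻¹ := by
  have hinj : Set.InjOn τ C := Finset.card_image_iff.1 (by rw [hS, hcard])
  rw [wSeq, hS]
  subst hS
  rw [Finset.prod_image hinj]

theorem wSeq_nonneg {n r : ℕ} {μ : Finset (Fin n) → ℝ} {p : Fin n → ℝ}
    (hμ : ∀ S, 0 ≤ μ S) (hp : ∀ i, 0 < p i) (τ : Fin r → Fin n) (C : Finset (Fin r)) :
    0 ≤ wSeq n r μ p τ C :=
  mul_nonneg (hμ _) (Finset.prod_nonneg fun _ _ => (inv_pos.2 (hp _)).le)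

theorem Zconst_nonneg {n k r : ℕ} {μ : Finset (Fin n) → ℝ} {p : Fin n → ℝ}
    (hμ : ∀ S, 0 ≤ μ S) (hp : ∀ i, 0 < p i) (τ : Fin r → Fin n) :
    0 ≤ Zconst n k r μ p τ :=
  Finset.sum_nonneg fun _ _ => wSeq_nonneg hμ hp _ _

theorem Zconst_le_genPoly {n k r : ℕ} {μ : Finset (Fin n) → ℝ} {p : Fin n → ℝ}
    (hμ : IsProbDistOn n k μ) (hp : ∀ i, 0 < p i) (τ : Fin r → Fin n) :
    Zconst n k r μ p τ ≤
      genPoly n k μ (fun j => (∑ i, if τ i = j then (1 : ℝ) else 0) / p j) := by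
  rw [Zconst, genPoly, ← Finset.sum_fiberwise _ (fun C : Finset (Fin r) => C.image τ),
    Finset.sum_filter]
  refine Finset.sum_le_sum fun S _ => ?_
  split_ifs with hS
  · rw [Finset.filter_filter,
      Finset.sum_congr rfl (g := fun _ => μ S * ∏ j ∈ S, (p j)⁻¹) fun C hC => by
        obtain ⟨h1, h2⟩ := (Finset.mem_filter.1 hC).2
        exact wSeq_eq_of_image_eq μ p (h1.trans hS.symm) h2]
    simp_rw [div_eq_mul_inv]
    rw [Finset.sum_const, nsmul_eq_mul, Finset.prod_mul_distrib, mul_left_comm]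
    refine mul_le_mul_of_nonneg_left (mul_le_mul_of_nonneg_right ?_
      (Finset.prod_nonneg fun _ _ => (inv_pos.2 (hp _)).le)) (hμ.1 S)
    have h := card_transversals_le τ S
    rw [hS] at h
    simp_rw [Finset.sum_boole]
    exact_mod_cast h
  · refine le_of_eq (Finset.sum_eq_zero fun C hC => ?_)
    rw [wSeq, (Finset.mem_filter.1 hC).2, hμ.2.1 S hS, zero_mul]

theorem sum_prod_mul_Zconst_le {n k r : ℕ} {μ : Finset (Fin n) → ℝ} {p : Fin n → ℝ}
    (hμ : IsProbDistOn n k μ) (hp : ∀ i, 0 < p i) (ρ : Fin r → Fin n → ℝ)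
    (hρ : ∀ i j, 0 ≤ ρ i j) (hρ1 : ∀ i, ∑ j, ρ i j = 1) :
    ∑ τ : Fin r → Fin n, (∏ i, ρ i (τ i)) * Zconst n k r μ p τ ≤
      genPoly n k μ (fun j => (∑ i, ρ i j) / p j) := by
  calc _ ≤ ∑ τ : Fin r → Fin n, (∏ i, ρ i (τ i)) *
          genPoly n k μ (fun j => (∑ i, if τ i = j then (1 : ℝ) else 0) / p j) :=
        Finset.sum_le_sum fun τ _ => mul_le_mul_of_nonneg_left (Zconst_le_genPoly hμ hp τ)
          (Finset.prod_nonneg fun _ _ => hρ _ _)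
    _ = ∑ S ∈ Finset.univ.filter (fun S : Finset (Fin n) => S.card = k),
          μ S * ((∑ τ : Fin r → Fin n, (∏ i, ρ i (τ i)) *
            ∏ j ∈ S, ∑ i, if τ i = j then (1 : ℝ) else 0) * ∏ j ∈ S, (p j)⁻¹) := by
        simp_rw [genPoly, Finset.mul_sum]
        rw [Finset.sum_comm]
        refine Finset.sum_congr rfl fun S _ => ?_
        rw [Finset.sum_mul, Finset.mul_sum]
        refine Finset.sum_congr rfl fun τ _ => ?_
        simp_rw [div_eq_mul_inv, Finset.prod_mul_distrib]
        ring
    _ ≤ _ := by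
        refine Finset.sum_le_sum fun S _ => mul_le_mul_of_nonneg_left ?_ (hμ.1 S)
        simp_rw [div_eq_mul_inv, Finset.prod_mul_distrib]
        refine mul_le_mul_of_nonneg_right ?_ (Finset.prod_nonneg fun _ _ => (inv_pos.2 (hp _)).le)
        have h := sum_prod_mul_prod_count_le ρ hρ hρ1 (fun j : S => (j : Fin n))
          Subtype.val_injective
        rw [Finset.prod_coe_sort S fun j => ∑ i, ρ i j] at h
        refine le_trans (le_of_eq (Finset.sum_congr rfl fun τ _ => ?_)) h
        rw [Finset.prod_coe_sort S fun j => ∑ i, if τ i = j then (1 : ℝ) else 0]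

theorem sum_filter_card_eq_one {n k : ℕ} {μ : Finset (Fin n) → ℝ} (hμ : IsProbDistOn n k μ) :
    ∑ S ∈ Finset.univ.filter (fun S : Finset (Fin n) => S.card = k), μ S = 1 := by
  rw [← hμ.2.2, Finset.sum_filter]
  refine Finset.sum_congr rfl fun S _ => ?_
  split_ifs with h
  · rfl
  · exact (hμ.2.1 S h).symm

theorem genPoly_nonneg {n k : ℕ} {μ : Finset (Fin n) → ℝ} (hμ : ∀ S, 0 ≤ μ S)
    {z : Fin n → ℝ} (hz : ∀ i, 0 ≤ z i) : 0 ≤ genPoly n k μ z :=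
  Finset.sum_nonneg fun _ _ => mul_nonneg (hμ _) (Finset.prod_nonneg fun _ _ => hz _)

theorem genPoly_one {n k : ℕ} {μ : Finset (Fin n) → ℝ} (hμ : IsProbDistOn n k μ) :
    genPoly n k μ (fun _ => 1) = 1 := by
  simpa [genPoly] using sum_filter_card_eq_one hμ

theorem genPoly_const_mul (n k : ℕ) (μ : Finset (Fin n) → ℝ) (s : ℝ) (z : Fin n → ℝ) :
    genPoly n k μ (fun i => s * z i) = s ^ k * genPoly n k μ z := by
  rw [genPoly, genPoly, Finset.mul_sum]
  refine Finset.sum_congr rfl fun S hS => ?_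
  rw [Finset.prod_mul_distrib, Finset.prod_const, (Finset.mem_filter.1 hS).2]
  ring

theorem hasDerivAt_genPoly_line {n k : ℕ} {μ : Finset (Fin n) → ℝ} (hμ : IsProbDistOn n k μ)
    (x : Fin n → ℝ) :
    HasDerivAt (fun lam : ℝ => genPoly n k μ (fun i => lam * x i + (1 - lam) * 1))
      (∑ i, marginal n μ i * (x i - 1)) 0 := by
  have h : HasDerivAt (fun lam : ℝ => genPoly n k μ (fun i => lam * x i + (1 - lam) * 1))
      (∑ S ∈ Finset.univ.filter (fun S : Finset (Fin n) => S.card = k),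
        μ S * ∑ i ∈ S, (x i - 1)) 0 := by
    unfold genPoly
    refine HasDerivAt.fun_sum fun S _ => HasDerivAt.const_mul _ ?_
    have h1 : ∀ i ∈ S, HasDerivAt (fun lam : ℝ => lam * x i + (1 - lam) * 1) (x i - 1) 0 := by
      intro i _
      have := ((hasDerivAt_id (0 : ℝ)).mul_const (x i)).add
        (((hasDerivAt_id (0 : ℝ)).const_sub 1).mul_const 1)
      refine this.congr_deriv ?_
      ring
    refine (HasDerivAt.fun_finsetProd h1).congr_deriv ?_
    simp
  refine h.congr_deriv ?_
  simp_rw [marginal, Finset.sum_mul, Finset.mul_sum]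
  rw [Finset.sum_filter]
  calc _ = ∑ S : Finset (Fin n), ∑ i, if i ∈ S then μ S * (x i - 1) else 0 := by
        refine Finset.sum_congr rfl fun S _ => ?_
        rw [← Finset.sum_filter, Finset.filter_mem_eq_inter, Finset.univ_inter]
        split_ifs with hS
        · rfl
        · simp [hμ.2.1 S hS]
    _ = _ := by
        rw [Finset.sum_comm]
        exact Finset.sum_congr rfl fun i _ => by rw [Finset.sum_filter]

theorem genPoly_le_exp {n k : ℕ} {μ : Finset (Fin n) → ℝ} (hμ : IsProbDistOn n k μ)
    (hlc : IsLogConcaveOn n (genPoly n k μ)) {x : Fin n → ℝ} (hx : ∀ i, 0 ≤ x i) :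
    genPoly n k μ x ≤ Real.exp (∑ i, marginal n μ i * (x i - 1)) := by
  rcases (genPoly_nonneg (k := k) hμ.1 hx).eq_or_lt with h0 | hpos
  · rw [← h0]
    exact (Real.exp_pos _).le
  rw [← Real.log_le_iff_le_exp hpos]
  have hd := (hasDerivAt_genPoly_line hμ x).sub
    (Real.hasStrictDerivAt_const_rpow hpos 0).hasDerivAt
  have ht := hd.tendsto_slope_zero_right
  have hnonneg : 0 ≤ ∑ i, marginal n μ i * (x i - 1) -
      genPoly n k μ x ^ (0 : ℝ) * Real.log (genPoly n k μ x) := by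
    refine ge_of_tendsto ht ?_
    filter_upwards [Ioo_mem_nhdsGT (zero_lt_one' ℝ)] with lam hlam
    refine smul_nonneg (inv_nonneg.2 hlam.1.le) ?_
    have := hlc x (fun _ => 1) hx (fun _ => zero_le_one) lam hlam.1 hlam.2
    rw [genPoly_one hμ, Real.one_rpow, mul_one] at this
    simpa [genPoly_one hμ] using this
  rw [Real.rpow_zero, one_mul] at hnonneg
  linarith

/-- The law on `α` of the `i`-th entry of a random sequence whose entries in `D` are fixed to
agree with `σ` and whose other entries are drawn from `p`. -/
noncomputable def plantedLaw {ι α : Type*} (p : α → ℝ) (D : Finset ι) (σ : ι → α)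
    (i : ι) (j : α) : ℝ :=
  if i ∈ D then (if j = σ i then 1 else 0) else p j

theorem plantedLaw_nonneg {ι α : Type*} {p : α → ℝ} (hp : ∀ j, 0 ≤ p j) (D : Finset ι)
    (σ : ι → α) (i : ι) (j : α) : 0 ≤ plantedLaw p D σ i j := by
  unfold plantedLaw
  split_ifs
  exacts [zero_le_one, le_rfl, hp j]

theorem sum_plantedLaw_eq_one {ι α : Type*} [Fintype α] {p : α → ℝ} (hp1 : ∑ j, p j = 1)
    (D : Finset ι) (σ : ι → α) (i : ι) : ∑ j, plantedLaw p D σ i j = 1 := by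
  unfold plantedLaw
  split_ifs <;> simp [hp1]

theorem prod_plantedLaw_of_agree {r n : ℕ} (p : Fin n → ℝ) {D : Finset (Fin r)}
    {σ τ : Fin r → Fin n} (h : ∀ i ∈ D, τ i = σ i) :
    ∏ i, plantedLaw p D σ i (τ i) = ∏ i ∈ Finset.univ \ D, p (τ i) := by
  rw [← Finset.prod_sdiff (Finset.subset_univ D)]
  have h1 : ∏ i ∈ D, plantedLaw p D σ i (τ i) = 1 :=
    Finset.prod_eq_one fun i hi => by simp [plantedLaw, hi, h i hi]
  rw [h1, mul_one]
  refine Finset.prod_congr rfl fun i hi => ?_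
  simp [plantedLaw, (Finset.mem_sdiff.1 hi).2]

theorem prod_plantedLaw_of_not_agree {r n : ℕ} (p : Fin n → ℝ) {D : Finset (Fin r)}
    {σ τ : Fin r → Fin n} (h : ¬ ∀ i ∈ D, τ i = σ i) :
    ∏ i, plantedLaw p D σ i (τ i) = 0 := by
  push Not at h
  obtain ⟨i, hi, hne⟩ := h
  exact Finset.prod_eq_zero (Finset.mem_univ i) (by simp [plantedLaw, hi, hne])

theorem sum_index_plantedLaw {r n : ℕ} (p : Fin n → ℝ) (D : Finset (Fin r))
    (σ : Fin r → Fin n) (j : Fin n) :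
    ∑ i, plantedLaw p D σ i j =
      ((Finset.univ \ D).card : ℝ) * p j + ∑ i ∈ D, if j = σ i then (1 : ℝ) else 0 := by
  rw [← Finset.sum_sdiff (Finset.subset_univ D)]
  congr 1
  · rw [← nsmul_eq_mul, ← Finset.sum_const]
    exact Finset.sum_congr rfl fun i hi => by simp [plantedLaw, (Finset.mem_sdiff.1 hi).2]
  · exact Finset.sum_congr rfl fun i hi => by simp [plantedLaw, hi]

theorem sum_plantedLaw_mul_Zconst_le {n k r : ℕ} {μ : Finset (Fin n) → ℝ} {p : Fin n → ℝ}
    (hμ : IsProbDistOn n k μ) (hlc : IsLogConcaveOn n (genPoly n k μ))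
    (hp : ∀ i, 0 < p i) (hp1 : ∑ i, p i = 1) {κ : ℝ} (hκ : ∀ i, marginal n μ i ≤ κ * p i)
    (D : Finset (Fin r)) (σ : Fin r → Fin n) {s : ℝ} (hs : 0 < s)
    (hsD : ((Finset.univ \ D).card : ℝ) = s) :
    ∑ τ : Fin r → Fin n, (∏ i, plantedLaw p D σ i (τ i)) * Zconst n k r μ p τ ≤
      s ^ k * Real.exp (D.card * κ / s) := by
  set v : Fin n → ℝ := fun j => ∑ i ∈ D, if j = σ i then (1 : ℝ) else 0 with hv
  have hv0 : ∀ j, 0 ≤ v j := fun j => Finset.sum_nonneg fun _ _ => by split_ifs <;> norm_num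
  have hsum : (fun j => (∑ i, plantedLaw p D σ i j) / p j) =
      fun j => s * (1 + v j / (s * p j)) := by
    funext j
    rw [sum_index_plantedLaw, hsD]
    have := (hp j).ne'
    field_simp
    rfl
  refine (sum_prod_mul_Zconst_le hμ hp _ (plantedLaw_nonneg (fun j => (hp j).le) D σ)
    (sum_plantedLaw_eq_one hp1 D σ)).trans ?_
  rw [hsum, genPoly_const_mul]
  refine mul_le_mul_of_nonneg_left ((genPoly_le_exp hμ hlc fun j => ?_).trans
    (Real.exp_le_exp.2 ?_)) (pow_pos hs k).le
  · have := div_nonneg (hv0 j) (mul_pos hs (hp j)).le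
    linarith
  · calc ∑ j, marginal n μ j * (1 + v j / (s * p j) - 1)
        ≤ ∑ j, κ / s * v j := by
          refine Finset.sum_le_sum fun j _ => ?_
          have h : marginal n μ j * (1 + v j / (s * p j) - 1) =
              marginal n μ j / p j * (v j / s) := by
            have := (hp j).ne'
            field_simp
            ring
          rw [h, show κ / s * v j = κ * (v j / s) by ring]
          exact mul_le_mul_of_nonneg_right ((div_le_iff₀ (hp j)).2 (hκ j))
            (div_nonneg (hv0 j) hs.le)
      _ = D.card * κ / s := by
          rw [← Finset.mul_sum, hv, Finset.sum_comm]
          simp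
          ring

theorem one_div_le_sum_div {ι : Type*} [Fintype ι] {ω Z : ι → ℝ} (hω : ∀ i, 0 ≤ ω i)
    (hω1 : ∑ i, ω i = 1) (hZ : ∀ i, ω i ≠ 0 → 0 < Z i) {M : ℝ} (hM : 0 < M)
    (hmean : ∑ i, ω i * Z i ≤ M) : 1 / M ≤ ∑ i, ω i / Z i := by
  calc 1 / M = (∑ i, ω i) * (2 / M) - M * (1 / M ^ 2) := by
        rw [hω1]
        field_simp
        ring
    _ ≤ (∑ i, ω i) * (2 / M) - (∑ i, ω i * Z i) * (1 / M ^ 2) := by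
        gcongr
    _ = ∑ i, ω i * (2 / M - Z i / M ^ 2) := by
        rw [Finset.sum_mul, Finset.sum_mul, ← Finset.sum_sub_distrib]
        exact Finset.sum_congr rfl fun i _ => by ring
    _ ≤ _ := by
        refine Finset.sum_le_sum fun i _ => ?_
        by_cases h : ω i = 0
        · simp [h]
        rw [div_eq_mul_inv (ω i)]
        refine mul_le_mul_of_nonneg_left ?_ (hω i)
        have hz := hZ i h
        rw [← sub_nonneg]
        have : (Z i)⁻¹ - (2 / M - Z i / M ^ 2) = (M - Z i) ^ 2 / (Z i * M ^ 2) := by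
          field_simp
          ring
        rw [this]
        positivity

theorem sum_ite_bijective {α β : Type*} [Fintype α] [Fintype β] [DecidableEq α] [DecidableEq β]
    (h : Fintype.card α = Fintype.card β) (x : ℝ) :
    ∑ b : α → β, (if Function.Bijective b then x else 0) = (Fintype.card α).factorial * x := by
  rw [← Finset.sum_filter, Finset.sum_const, nsmul_eq_mul,
    ← Fintype.card_equiv (Fintype.equivOfCardEq h)]
  congr 2
  rw [← Fintype.card_subtype]
  exact Fintype.card_congr
    ⟨fun b => Equiv.ofBijective b.1 b.2, fun e => ⟨e, e.bijective⟩, fun _ => rfl,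
      fun e => Equiv.ext fun _ => rfl⟩

theorem exists_extension {ι α : Type*} [Nonempty α] {A : Finset ι} {S : Finset α}
    (b : {x // x ∈ A} → {y // y ∈ S}) : ∃ σ : ι → α, ∀ i : {x // x ∈ A}, σ i.1 = (b i).1 :=
  ⟨fun i => if h : i ∈ A then (b ⟨i, h⟩).1 else Classical.arbitrary α, fun i => by simp⟩

theorem image_eq_of_bijective {ι α : Type*} [DecidableEq α] {A : Finset ι} {S : Finset α}
    {τ : ι → α} {b : {x // x ∈ A} → {y // y ∈ S}} (hb : Function.Bijective b)
    (hτ : ∀ i : {x // x ∈ A}, τ i.1 = (b i).1) : A.image τ = S := by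
  ext y
  rw [Finset.mem_image]
  constructor
  · rintro ⟨i, hi, rfl⟩
    rw [hτ ⟨i, hi⟩]
    exact (b ⟨i, hi⟩).2
  · intro hy
    obtain ⟨i, hi⟩ := hb.2 ⟨y, hy⟩
    exact ⟨i.1, i.2, by rw [hτ i, hi]⟩

theorem muTau_nonneg {n k r : ℕ} {μ : Finset (Fin n) → ℝ} {p : Fin n → ℝ}
    (hμ : ∀ S, 0 ≤ μ S) (hp : ∀ i, 0 < p i) (τ : Fin r → Fin n) (C : Finset (Fin r)) :
    0 ≤ muTau n k r μ p τ C := by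
  unfold muTau
  split_ifs
  exacts [le_rfl, div_nonneg (wSeq_nonneg hμ hp _ _) (Zconst_nonneg hμ hp _)]

theorem sum_muTau_le_one (n k r : ℕ) (μ : Finset (Fin n) → ℝ) (p : Fin n → ℝ)
    (τ : Fin r → Fin n) :
    ∑ C ∈ Finset.univ.filter (fun C : Finset (Fin r) => C.card = k), muTau n k r μ p τ C ≤ 1 := by
  by_cases h : Zconst n k r μ p τ = 0
  · simp [muTau, h]
  · simp only [muTau, if_neg h]
    rw [← Finset.sum_div]
    exact (div_self h).le

theorem interDist_nonneg {n k r : ℕ} {p : Fin n → ℝ} (hp : ∀ i, 0 < p i) (S₀ : Finset (Fin n))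
    (τ : Fin r → Fin n) : 0 ≤ interDist n k r p S₀ τ := by
  refine mul_nonneg (by positivity) (Finset.sum_nonneg fun A _ => Finset.sum_nonneg fun b _ => ?_)
  split_ifs
  exacts [Finset.prod_nonneg fun i _ => (hp _).le, le_rfl]

theorem kernel_nonneg {n k t : ℕ} {μ : Finset (Fin n) → ℝ} {p : Fin n → ℝ}
    (hμ : ∀ S, 0 ≤ μ S) (hp : ∀ i, 0 < p i) (S₀ S₁ : Finset (Fin n)) :
    0 ≤ kernel n k t μ p S₀ S₁ :=
  Finset.sum_nonneg fun _ _ => mul_nonneg (interDist_nonneg hp _ _)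
    (Finset.sum_nonneg fun _ _ => muTau_nonneg hμ hp _ _)

theorem card_filter_card_eq (r k : ℕ) :
    (Finset.univ.filter (fun A : Finset (Fin r) => A.card = k)).card = r.choose k := by
  rw [Finset.univ_filter_card_eq, Finset.card_powersetCard, Finset.card_univ, Fintype.card_fin]

theorem sum_interDist_eq_one {n k r : ℕ} [Nonempty (Fin n)] (hkr : k ≤ r) {p : Fin n → ℝ}
    (hp1 : ∑ i, p i = 1) {S₀ : Finset (Fin n)} (hS₀ : S₀.card = k) :
    ∑ τ : Fin r → Fin n, interDist n k r p S₀ τ = 1 := by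
  simp only [interDist]
  rw [← Finset.mul_sum, Finset.sum_comm,
    Finset.sum_congr rfl (g := fun _ => (k.factorial : ℝ)) ?_]
  · rw [Finset.sum_const, card_filter_card_eq, nsmul_eq_mul]
    have h1 : (k.factorial : ℝ) ≠ 0 := by positivity
    have h2 : (r.choose k : ℝ) ≠ 0 := by exact_mod_cast (Nat.choose_pos hkr).ne'
    field_simp
  · intro A hA
    have hA := (Finset.mem_filter.1 hA).2
    rw [Finset.sum_comm]
    have h := sum_ite_bijective (α := {x // x ∈ A}) (β := {y // y ∈ S₀})
      (by simp [hA, hS₀]) 1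
    rw [Fintype.card_coe, hA, mul_one] at h
    rw [← h]
    refine Finset.sum_congr rfl fun b _ => ?_
    obtain ⟨σ, hσ⟩ := exists_extension b
    by_cases hb : Function.Bijective b
    · rw [if_pos hb, ← sum_prod_apply_eq_one _ (sum_plantedLaw_eq_one hp1 A σ)]
      refine Finset.sum_congr rfl fun τ _ => ?_
      split_ifs with hτ
      · exact (prod_plantedLaw_of_agree p fun i hi =>
          (hτ.2 ⟨i, hi⟩).trans (hσ ⟨i, hi⟩).symm).symm
      · refine (prod_plantedLaw_of_not_agree p fun hagree => hτ ⟨hb, fun i => ?_⟩).symm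
        rw [hagree i.1 i.2, hσ i]
    · rw [if_neg hb]
      exact Finset.sum_eq_zero fun τ _ => if_neg fun h => hb h.1

theorem sum_kernel_le_one {n k t : ℕ} [Nonempty (Fin n)] {μ : Finset (Fin n) → ℝ}
    {p : Fin n → ℝ} (hμ : ∀ S, 0 ≤ μ S) (hp : ∀ i, 0 < p i) (hp1 : ∑ i, p i = 1)
    {S₀ : Finset (Fin n)} (hS₀ : S₀.card = k) :
    ∑ S₁ ∈ Finset.univ.filter (fun S : Finset (Fin n) => S.card = k),
      kernel n k t μ p S₀ S₁ ≤ 1 := by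
  rw [← sum_interDist_eq_one (Nat.le_add_left k t) hp1 hS₀]
  simp only [kernel]
  rw [Finset.sum_comm]
  refine Finset.sum_le_sum fun τ _ => ?_
  rw [← Finset.mul_sum]
  refine mul_le_of_le_one_right (interDist_nonneg hp _ _) ?_
  refine le_trans ?_ (sum_muTau_le_one n k (t + k) μ p τ)
  rw [← Finset.sum_fiberwise _ (fun C : Finset (Fin (t + k)) => C.image τ)]
  simp only [Finset.filter_filter]
  exact Finset.sum_le_sum_of_subset_of_nonneg (Finset.filter_subset _ _)
    fun _ _ _ => Finset.sum_nonneg fun _ _ => muTau_nonneg hμ hp _ _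

theorem sum_ite_bijective_agree_le {ι α : Type*} [DecidableEq ι] [DecidableEq α]
    {B : Finset ι} {S : Finset α} (τ : ι → α) {x : ℝ} (hx : 0 ≤ x) :
    ∑ b : {i // i ∈ B} → {y // y ∈ S},
      (if Function.Bijective b ∧ ∀ i : {i // i ∈ B}, τ i.1 = (b i).1 then x else 0) ≤
      if B.image τ = S then x else 0 := by
  rw [← Finset.sum_filter, Finset.sum_const, nsmul_eq_mul]
  split_ifs with h
  · refine mul_le_of_le_one_left hx ?_
    norm_cast
    refine Finset.card_le_one.2 fun b hb b' hb' => funext fun i => Subtype.ext ?_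
    rw [← (Finset.mem_filter.1 hb).2.2 i, (Finset.mem_filter.1 hb').2.2 i]
  · rw [Finset.filter_false_of_mem fun b _ hb => h (image_eq_of_bijective hb.1 hb.2)]
    simp

theorem div_le_sum_planted_mul_muTau {n k r : ℕ} [Nonempty (Fin n)]
    {μ : Finset (Fin n) → ℝ} {p : Fin n → ℝ}
    (hμ : IsProbDistOn n k μ) (hlc : IsLogConcaveOn n (genPoly n k μ))
    (hp : ∀ i, 0 < p i) (hp1 : ∑ i, p i = 1) {κ : ℝ} (hκ : ∀ i, marginal n μ i ≤ κ * p i)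
    {s : ℝ} (hs : 0 < s) (hsr : s = r - 2 * k) {S₀ S₁ : Finset (Fin n)} (hS₁ : 0 < μ S₁)
    {A B : Finset (Fin r)} (hA : A.card = k) (hB : B.card = k) (hAB : Disjoint A B)
    {b₀ : {x // x ∈ A} → {y // y ∈ S₀}} (hb₀ : Function.Bijective b₀)
    {b₁ : {x // x ∈ B} → {y // y ∈ S₁}} (hb₁ : Function.Bijective b₁) :
    μ S₁ / (s ^ k * Real.exp (2 * k * κ / s)) ≤
      ∑ τ : Fin r → Fin n,
        (if Function.Bijective b₀ ∧ ∀ i : {x // x ∈ A}, τ i.1 = (b₀ i).1 then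
          ∏ i ∈ Finset.univ \ A, p (τ i) else 0) *
        (if Function.Bijective b₁ ∧ ∀ i : {x // x ∈ B}, τ i.1 = (b₁ i).1 then
          muTau n k r μ p τ B else 0) := by
  obtain ⟨σ₀, hσ₀⟩ := exists_extension b₀
  obtain ⟨σ₁, hσ₁⟩ := exists_extension b₁
  set σ : Fin r → Fin n := A.piecewise σ₀ σ₁ with hσ
  have hAσ : ∀ i : {x // x ∈ A}, σ i.1 = (b₀ i).1 := fun i => by
    rw [hσ, Finset.piecewise_eq_of_mem _ _ _ i.2, hσ₀]
  have hBσ : ∀ i : {x // x ∈ B}, σ i.1 = (b₁ i).1 := fun i => by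
    rw [hσ, Finset.piecewise_eq_of_notMem _ _ _ (Finset.disjoint_right.1 hAB i.2), hσ₁]
  have hcard : (A ∪ B).card = 2 * k := by
    rw [Finset.card_union_of_disjoint hAB, hA, hB, two_mul]
  have hsD : ((Finset.univ \ (A ∪ B)).card : ℝ) = s := by
    have h := Finset.card_sdiff_add_card_eq_card (Finset.subset_univ (A ∪ B))
    rw [hcard, Finset.card_univ, Fintype.card_fin] at h
    have h' : ((Finset.univ \ (A ∪ B)).card : ℝ) + 2 * k = r := by exact_mod_cast h
    linarith
  have hagree : ∀ τ : Fin r → Fin n, (∀ i ∈ A ∪ B, τ i = σ i) ↔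
      (∀ i : {x // x ∈ A}, τ i.1 = (b₀ i).1) ∧ ∀ i : {x // x ∈ B}, τ i.1 = (b₁ i).1 := by
    intro τ
    constructor
    · intro h
      exact ⟨fun i => (h i.1 (Finset.mem_union_left _ i.2)).trans (hAσ i),
        fun i => (h i.1 (Finset.mem_union_right _ i.2)).trans (hBσ i)⟩
    · rintro ⟨h0, h1⟩ i hi
      rcases Finset.mem_union.1 hi with h | h
      · exact (h0 ⟨i, h⟩).trans (hAσ ⟨i, h⟩).symm
      · exact (h1 ⟨i, h⟩).trans (hBσ ⟨i, h⟩).symm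
  have hw : ∀ τ : Fin r → Fin n, (∀ i : {x // x ∈ B}, τ i.1 = (b₁ i).1) →
      wSeq n r μ p τ B = μ S₁ * ∏ i ∈ B, (p (τ i))⁻¹ := fun τ hτ => by
    rw [wSeq, image_eq_of_bijective hb₁ hτ]
  have hZ : ∀ τ : Fin r → Fin n, (∀ i : {x // x ∈ B}, τ i.1 = (b₁ i).1) →
      0 < Zconst n k r μ p τ := fun τ hτ => by
    have hwpos : 0 < wSeq n r μ p τ B := by
      rw [hw τ hτ]
      exact mul_pos hS₁ (Finset.prod_pos fun i _ => inv_pos.2 (hp _))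
    exact hwpos.trans_le (Finset.single_le_sum (f := fun C => wSeq n r μ p τ C)
      (fun C _ => wSeq_nonneg hμ.1 hp τ C) (Finset.mem_filter.2 ⟨Finset.mem_univ B, hB⟩))
  have hmean := sum_plantedLaw_mul_Zconst_le hμ hlc hp hp1 hκ (A ∪ B) σ hs hsD
  rw [hcard] at hmean
  push_cast at hmean
  have hJ := one_div_le_sum_div
    (ω := fun τ : Fin r → Fin n => ∏ i, plantedLaw p (A ∪ B) σ i (τ i))
    (fun τ => Finset.prod_nonneg fun i _ => plantedLaw_nonneg (fun j => (hp j).le) _ _ _ _)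
    (sum_prod_apply_eq_one _ (sum_plantedLaw_eq_one hp1 (A ∪ B) σ))
    (fun τ hτ => hZ τ ((hagree τ).1 (not_not.1 fun h => hτ (prod_plantedLaw_of_not_agree p h))).2)
    (mul_pos (pow_pos hs k) (Real.exp_pos _)) hmean
  rw [div_eq_mul_one_div]
  refine (mul_le_mul_of_nonneg_left hJ hS₁.le).trans (le_of_eq ?_)
  rw [Finset.mul_sum]
  refine Finset.sum_congr rfl fun τ _ => ?_
  by_cases h : ∀ i ∈ A ∪ B, τ i = σ i
  · obtain ⟨h0, h1⟩ := (hagree τ).1 h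
    rw [if_pos ⟨hb₀, h0⟩, if_pos ⟨hb₁, h1⟩, prod_plantedLaw_of_agree p h, muTau,
      if_neg (hZ τ h1).ne', hw τ h1, Finset.prod_inv_distrib,
      ← Finset.prod_sdiff (s₁ := B) (s₂ := Finset.univ \ A), sdiff_sdiff_left]
    · have : ∏ i ∈ B, p (τ i) ≠ 0 := (Finset.prod_pos fun i _ => hp _).ne'
      simp only [Finset.sup_eq_union]
      field_simp
    · exact fun i hi => Finset.mem_sdiff.2 ⟨Finset.mem_univ i, Finset.disjoint_right.1 hAB hi⟩
  · rw [prod_plantedLaw_of_not_agree p h, zero_div, mul_zero]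
    rw [hagree τ, not_and_or] at h
    rcases h with h | h
    · rw [if_neg (fun h' => h h'.2), zero_mul]
    · rw [if_neg (c := Function.Bijective b₁ ∧ _) (fun h' => h h'.2), mul_zero]

theorem mul_div_le_kernel {n k t : ℕ} [Nonempty (Fin n)] {μ : Finset (Fin n) → ℝ}
    {p : Fin n → ℝ} (hμ : IsProbDistOn n k μ) (hlc : IsLogConcaveOn n (genPoly n k μ))
    (hp : ∀ i, 0 < p i) (hp1 : ∑ i, p i = 1) {κ : ℝ} (hκ : ∀ i, marginal n μ i ≤ κ * p i)
    (hkt : k < t) {S₀ S₁ : Finset (Fin n)} (hS₀ : S₀.card = k) (hS₁ : 0 < μ S₁) :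
    μ S₁ * (t.descFactorial k / (((t : ℝ) - k) ^ k * Real.exp (2 * k * κ / ((t : ℝ) - k)))) ≤
      kernel n k t μ p S₀ S₁ := by
  have hs : (0 : ℝ) < (t : ℝ) - k := sub_pos.2 (by exact_mod_cast hkt)
  have hS₁k : S₁.card = k := not_not.1 fun h => hS₁.ne' (hμ.2.1 S₁ h)
  set m : ℝ := ((t : ℝ) - k) ^ k * Real.exp (2 * k * κ / ((t : ℝ) - k)) with hm
  have hm0 : 0 < m := mul_pos (pow_pos hs k) (Real.exp_pos _)
  set f : Finset (Fin (t + k)) → (Fin (t + k) → Fin n) → ℝ := fun A τ =>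
    ∑ b : {x // x ∈ A} → {y // y ∈ S₀},
      if Function.Bijective b ∧ ∀ i : {x // x ∈ A}, τ i.1 = (b i).1 then
        ∏ i ∈ Finset.univ \ A, p (τ i) else 0 with hf
  set g : Finset (Fin (t + k)) → (Fin (t + k) → Fin n) → ℝ := fun B τ =>
    ∑ b : {x // x ∈ B} → {y // y ∈ S₁},
      if Function.Bijective b ∧ ∀ i : {x // x ∈ B}, τ i.1 = (b i).1 then
        muTau n k (t + k) μ p τ B else 0 with hg
  have hf0 : ∀ A τ, 0 ≤ f A τ := fun A τ => Finset.sum_nonneg fun b _ => by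
    split_ifs
    exacts [Finset.prod_nonneg fun i _ => (hp _).le, le_rfl]
  have hg_le : ∀ A τ, ∑ B ∈ (Finset.univ \ A).powersetCard k, g B τ ≤
      ∑ S ∈ Finset.univ.filter
        (fun S : Finset (Fin (t + k)) => S.card = k ∧ S.image τ = S₁),
        muTau n k (t + k) μ p τ S := by
    intro A τ
    rw [← Finset.filter_filter, Finset.sum_filter (fun S => Finset.image τ S = S₁)]
    refine (Finset.sum_le_sum fun B _ =>
      sum_ite_bijective_agree_le τ (muTau_nonneg hμ.1 hp τ B)).trans ?_
    refine Finset.sum_le_sum_of_subset_of_nonneg (fun B hB => ?_) fun B _ _ => ?_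
    · exact Finset.mem_filter.2 ⟨Finset.mem_univ B, (Finset.mem_powersetCard.1 hB).2⟩
    · split_ifs
      exacts [muTau_nonneg hμ.1 hp τ B, le_rfl]
  have hpair : ∀ A ∈ Finset.univ.filter (fun A : Finset (Fin (t + k)) => A.card = k),
      ∀ B ∈ (Finset.univ \ A).powersetCard k,
        (k.factorial : ℝ) * (k.factorial * (μ S₁ / m)) ≤ ∑ τ, f A τ * g B τ := by
    intro A hA B hB
    have hA := (Finset.mem_filter.1 hA).2
    obtain ⟨hBA, hB⟩ := Finset.mem_powersetCard.1 hB
    have hAB : Disjoint A B := Finset.disjoint_right.2 fun i hi => (Finset.mem_sdiff.1 (hBA hi)).2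
    have h₀ := sum_ite_bijective (α := {x // x ∈ A}) (β := {y // y ∈ S₀})
      (by simp [hA, hS₀]) (k.factorial * (μ S₁ / m))
    have h₁ := sum_ite_bijective (α := {x // x ∈ B}) (β := {y // y ∈ S₁})
      (by simp [hB, hS₁k]) (μ S₁ / m)
    rw [Fintype.card_coe, hA] at h₀
    rw [Fintype.card_coe, hB] at h₁
    simp only [hf, hg, Finset.sum_mul_sum]
    rw [← h₀, Finset.sum_comm]
    refine Finset.sum_le_sum fun b₀ _ => ?_
    rw [Finset.sum_comm]
    have hnonneg : ∀ b₁ : {x // x ∈ B} → {y // y ∈ S₁}, 0 ≤ ∑ τ : Fin (t + k) → Fin n,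
        (if Function.Bijective b₀ ∧ ∀ i : {x // x ∈ A}, τ i.1 = (b₀ i).1 then
          ∏ i ∈ Finset.univ \ A, p (τ i) else 0) *
        (if Function.Bijective b₁ ∧ ∀ i : {x // x ∈ B}, τ i.1 = (b₁ i).1 then
          muTau n k (t + k) μ p τ B else 0) := by
      refine fun b₁ => Finset.sum_nonneg fun τ _ => mul_nonneg ?_ ?_ <;> split_ifs
      exacts [Finset.prod_nonneg fun i _ => (hp _).le, le_rfl, muTau_nonneg hμ.1 hp τ B, le_rfl]
    by_cases hb₀ : Function.Bijective b₀
    · rw [if_pos hb₀, ← h₁]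
      refine Finset.sum_le_sum fun b₁ _ => ?_
      by_cases hb₁ : Function.Bijective b₁
      · rw [if_pos hb₁]
        exact div_le_sum_planted_mul_muTau hμ hlc hp hp1 hκ hs (by push_cast; ring) hS₁ hA hB
          hAB hb₀ hb₁
      · rw [if_neg hb₁]
        exact hnonneg b₁
    · rw [if_neg hb₀]
      exact Finset.sum_nonneg fun b₁ _ => hnonneg b₁
  have hfac : (k.factorial : ℝ) ≠ 0 := by positivity
  have hchoose : ((t + k).choose k : ℝ) ≠ 0 := by
    exact_mod_cast (Nat.choose_pos (Nat.le_add_left k t)).ne'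
  have hcount : μ S₁ * (t.descFactorial k / m) =
      (1 / ((k.factorial : ℝ) * ((t + k).choose k : ℝ))) *
        ∑ A ∈ Finset.univ.filter (fun A : Finset (Fin (t + k)) => A.card = k),
          ∑ _B ∈ (Finset.univ \ A).powersetCard k,
            (k.factorial : ℝ) * (k.factorial * (μ S₁ / m)) := by
    rw [Finset.sum_congr rfl (g := fun _ => (t.choose k : ℝ) *
      ((k.factorial : ℝ) * (k.factorial * (μ S₁ / m)))) fun A hA => ?_]
    · rw [Finset.sum_const, card_filter_card_eq, nsmul_eq_mul,
        Nat.descFactorial_eq_factorial_mul_choose]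
      push_cast
      field_simp
    · rw [Finset.sum_const, Finset.card_powersetCard, nsmul_eq_mul,
        Finset.card_sdiff_of_subset (Finset.subset_univ A), Finset.card_univ, Fintype.card_fin,
        (Finset.mem_filter.1 hA).2, Nat.add_sub_cancel]
  rw [hcount]
  calc _ ≤ (1 / ((k.factorial : ℝ) * ((t + k).choose k : ℝ))) *
        ∑ A ∈ Finset.univ.filter (fun A : Finset (Fin (t + k)) => A.card = k),
          ∑ B ∈ (Finset.univ \ A).powersetCard k, ∑ τ, f A τ * g B τ :=
        mul_le_mul_of_nonneg_left (Finset.sum_le_sum fun A hA => Finset.sum_le_sum fun B hB =>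
          hpair A hA B hB) (by positivity)
    _ = (1 / ((k.factorial : ℝ) * ((t + k).choose k : ℝ))) *
        ∑ τ, ∑ A ∈ Finset.univ.filter (fun A : Finset (Fin (t + k)) => A.card = k),
          f A τ * ∑ B ∈ (Finset.univ \ A).powersetCard k, g B τ := by
        rw [Finset.sum_comm (s := (Finset.univ : Finset (Fin (t + k) → Fin n)))]
        congr 1
        refine Finset.sum_congr rfl fun A _ => ?_
        rw [Finset.sum_comm]
        exact Finset.sum_congr rfl fun τ _ => (Finset.mul_sum _ _ _).symm
    _ ≤ kernel n k t μ p S₀ S₁ := by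
        rw [kernel, Finset.mul_sum]
        refine Finset.sum_le_sum fun τ _ => ?_
        rw [interDist, mul_assoc, Finset.sum_mul]
        exact mul_le_mul_of_nonneg_left (Finset.sum_le_sum fun A _ =>
          mul_le_mul_of_nonneg_left (hg_le A τ) (hf0 A τ)) (by positivity)

theorem half_sum_abs_sub_le {ι : Type*} {s : Finset ι} {P μ : ι → ℝ} {ε : ℝ}
    (hμ : ∀ i ∈ s, 0 ≤ μ i) (hμ1 : ∑ i ∈ s, μ i = 1) (hP1 : ∑ i ∈ s, P i ≤ 1) (hε : 0 ≤ ε)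
    (h : ∀ i ∈ s, (1 - ε) * μ i ≤ P i) : 1 / 2 * ∑ i ∈ s, |P i - μ i| ≤ ε := by
  have h1 : ∑ i ∈ s, |P i - μ i| ≤ ∑ i ∈ s, (P i - μ i + 2 * ε * μ i) := by
    refine Finset.sum_le_sum fun i hi => abs_le.2 ⟨?_, ?_⟩
    · linarith [h i hi]
    · linarith [mul_nonneg hε (hμ i hi)]
  rw [Finset.sum_add_distrib, Finset.sum_sub_distrib, ← Finset.mul_sum, hμ1] at h1
  linarith

theorem one_sub_le_descFactorial_div {k t : ℕ} {c : ℝ} (hk : 1 ≤ k) (hc : 5 < c)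
    (ht : c * (k : ℝ) ^ 2 ≤ t) :
    1 - 5 / c ≤ t.descFactorial k / (((t : ℝ) - k) ^ k *
      Real.exp (2 * k * (k * (1 + 1 / (c * k))) / ((t : ℝ) - k))) := by
  have hk1 : (1 : ℝ) ≤ k := by exact_mod_cast hk
  have hs : (0 : ℝ) < (t : ℝ) - k := by nlinarith
  have hkt : k ≤ t := by
    have : (k : ℝ) ≤ t := by linarith
    exact_mod_cast this
  have hexp : 2 * k * (k * (1 + 1 / (c * k))) / ((t : ℝ) - k) ≤ 5 / c := by
    rw [div_le_div_iff₀ hs (by linarith)]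
    have : 2 * k * (k * (1 + 1 / (c * k))) * c = 2 * c * (k : ℝ) ^ 2 + 2 * k := by
      field_simp
    rw [this]
    nlinarith
  have hdesc : ((t : ℝ) - k) ^ k ≤ t.descFactorial k := by
    have h : (((t + 1 - k) ^ k : ℕ) : ℝ) ≤ t.descFactorial k := by
      exact_mod_cast Nat.pow_sub_le_descFactorial t k
    refine le_trans ?_ h
    push_cast [Nat.cast_sub (show k ≤ t + 1 by omega)]
    exact pow_le_pow_left₀ hs.le (by linarith) k
  calc 1 - 5 / c ≤ Real.exp (-(5 / c)) := by linarith [Real.add_one_le_exp (-(5 / c))]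
    _ ≤ Real.exp (-(2 * k * (k * (1 + 1 / (c * k))) / ((t : ℝ) - k))) :=
        Real.exp_le_exp.2 (neg_le_neg hexp)
    _ = ((t : ℝ) - k) ^ k / (((t : ℝ) - k) ^ k *
          Real.exp (2 * k * (k * (1 + 1 / (c * k))) / ((t : ℝ) - k))) := by
        have := (pow_pos hs k).ne'
        rw [Real.exp_neg]
        field_simp
    _ ≤ _ := by gcongr

theorem one_step_mixing
    (n k : ℕ) (hk : 1 ≤ k) (hkn : k ≤ n)
    (μ : Finset (Fin n) → ℝ) (hμ : IsProbDistOn n k μ)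
    (hlc : IsLogConcaveOn n (genPoly n k μ))
    (p : Fin n → ℝ) (hp : ∀ i, 0 < p i) (hp1 : ∑ i : Fin n, p i = 1)
    (c : ℝ) (hc : 1 < c) (t : ℕ) (ht : c * (k : ℝ) ^ 2 ≤ (t : ℝ))
    (hmarg : ∀ i, (1 + 1 / (c * (k : ℝ)))⁻¹ * marginal n μ i ≤ (k : ℝ) * p i)
    (S₀ : Finset (Fin n)) (hS₀ : μ S₀ ≠ 0) :
    (1 / 2) * ∑ S₁ ∈ Finset.univ.filter (fun S : Finset (Fin n) => S.card = k),
        |kernel n k t μ p S₀ S₁ - μ S₁| ≤ 5 / c := by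
  have : Nonempty (Fin n) := ⟨⟨0, by omega⟩⟩
  have hc0 : 0 < c := by linarith
  have hS₀k : S₀.card = k := not_not.1 fun h => hS₀ (hμ.2.1 S₀ h)
  refine half_sum_abs_sub_le (fun S _ => hμ.1 S) (sum_filter_card_eq_one hμ)
    (sum_kernel_le_one hμ.1 hp hp1 hS₀k) (by positivity) fun S₁ _ => ?_
  by_cases hc5 : 5 < c
  · rcases (hμ.1 S₁).eq_or_lt with h0 | hpos
    · rw [← h0, mul_zero]
      exact kernel_nonneg hμ.1 hp _ _
    have hk1 : (1 : ℝ) ≤ k := by exact_mod_cast hk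
    have hkt : k < t := by
      have : (k : ℝ) < t := by nlinarith
      exact_mod_cast this
    have hκ : ∀ i, marginal n μ i ≤ k * (1 + 1 / (c * k)) * p i := fun i => by
      have h := (inv_mul_le_iff₀ (by positivity)).1 (hmarg i)
      linarith
    rw [mul_comm]
    exact (mul_le_mul_of_nonneg_left (one_sub_le_descFactorial_div hk hc5 ht) hpos.le).trans
      (mul_div_le_kernel hμ hlc hp hp1 hκ hkt hS₀k hpos)
  · refine le_trans (mul_nonpos_of_nonpos_of_nonneg ?_ (hμ.1 S₁)) (kernel_nonneg hμ.1 hp _ _)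
    rw [sub_nonpos, le_div_iff₀ hc0]
    linarith
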